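/- For all natural numbers n ≥ 2 and k ≥ 1: 𝔢̄_n^const(k) = 𝔢_n^const(k) = 𝔢_2^const(k). That is, the least cardinality of a family F ⊆ n^ω such that no single predictor weakly k-constantly predicts all of F, the least cardinality of a family F ⊆ n^ω such that no single predictor k-constantly predicts all of F, and the least cardinality of a family F ⊆ 2^ω such that no single predictor k-constantly predicts all of F all coincide. -/

import Mathlib

open Cardinal

/-- The initial segment `x↾i` of `x : n^ω`, as a finite sequence. -/
def seg {n : ℕ} (x : ℕ → Fin n) (i : ℕ) : List (Fin n) :=
  List.ofFn (fun j : Fin i => x j)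

/-- `π` k-constantly predicts `x`: for all but finitely many `m` there is
`i ∈ [m, m+k)` with `x i = π (x↾i)`. -/
def KPred {n : ℕ} (k : ℕ) (π : List (Fin n) → Fin n) (x : ℕ → Fin n) : Prop :=
  ∃ N, ∀ m, N ≤ m → ∃ i, m ≤ i ∧ i < m + k ∧ x i = π (seg x i)

/-- `π` weakly k-constantly predicts `x`: for all but finitely many `m` there is
`i < k` with `x (m*k+i) = π (x↾(m*k+i))`. -/
def WPred {n : ℕ} (k : ℕ) (π : List (Fin n) → Fin n) (x : ℕ → Fin n) : Prop :=
  ∃ N, ∀ m, N ≤ m → ∃ i, i < k ∧ x (m * k + i) = π (seg x (m * k + i))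

/-- The k-constant prediction number 𝔳ₙᶜᵒⁿˢᵗ(k). -/
noncomputable def vConst (n k : ℕ) : Cardinal :=
  sInf { c | ∃ P : Set (List (Fin n) → Fin n), #P = c ∧
    ∀ x : ℕ → Fin n, ∃ π ∈ P, KPred k π x }

/-- The weak k-constant prediction number 𝔳̄ₙᶜᵒⁿˢᵗ(k). -/
noncomputable def vBar (n k : ℕ) : Cardinal :=
  sInf { c | ∃ P : Set (List (Fin n) → Fin n), #P = c ∧
    ∀ x : ℕ → Fin n, ∃ π ∈ P, WPred k π x }

/-- The k-constant evasion number 𝔢ₙᶜᵒⁿˢᵗ(k). -/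
noncomputable def eConst (n k : ℕ) : Cardinal :=
  sInf { c | ∃ F : Set (ℕ → Fin n), #F = c ∧
    ∀ π : List (Fin n) → Fin n, ∃ x ∈ F, ¬ KPred k π x }

/-- The weak k-constant evasion number 𝔢̄ₙᶜᵒⁿˢᵗ(k). -/
noncomputable def eBar (n k : ℕ) : Cardinal :=
  sInf { c | ∃ F : Set (ℕ → Fin n), #F = c ∧
    ∀ π : List (Fin n) → Fin n, ∃ x ∈ F, ¬ WPred k π x }

/-- The evasion number of a prediction relation `P`: the least size of a family of points that is
not predicted by a single predictor. -/
noncomputable def evasionNumber {A X : Type} (P : A → X → Prop) : Cardinal :=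
  sInf { c | ∃ F : Set X, #F = c ∧ ∀ π : A, ∃ x ∈ F, ¬ P π x }

/-- Tukey-style comparison: points of `X'` are translated to a family of points of `X`, and a
family of predictors for `X` is translated back to one predictor for `X'`. -/
theorem evasionNumber_le {A X A' X' ι : Type} {P : A → X → Prop} {P' : A' → X' → Prop}
    (f : ι → X' → X)
    (h : ∀ π : ι → A, ∃ π' : A', ∀ x, (∀ j, P (π j) (f j x)) → P' π' x)
    (hne : ∀ π : A', ∃ x, ¬ P' π x) :
    evasionNumber P ≤ evasionNumber P' := by
  refine le_csInf ⟨_, Set.univ, rfl, fun π => by simpa using hne π⟩ ?_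
  rintro c ⟨F, rfl, hF⟩
  obtain ⟨j, hj⟩ : ∃ j, ∀ π : A, ∃ x ∈ f j '' F, ¬ P π x := by
    by_contra! hcon
    choose π hπ using hcon
    obtain ⟨π', hπ'⟩ := h π
    obtain ⟨x, hx, hnx⟩ := hF π'
    exact hnx (hπ' x fun j => hπ j _ ⟨x, hx, rfl⟩)
  calc evasionNumber P ≤ #(f j '' F) := csInf_le' ⟨_, rfl, hj⟩
    _ ≤ #F := Cardinal.mk_image_le

theorem seg_congr {n : ℕ} {x y : ℕ → Fin n} {i : ℕ} (h : ∀ j < i, x j = y j) :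
    seg x i = seg y i := by
  unfold seg
  congr 1
  funext j
  exact h j j.2

theorem seg_succ {n : ℕ} (x : ℕ → Fin n) (i : ℕ) : seg x (i + 1) = seg x i ++ [x i] := by
  rw [seg, List.ofFn_succ', List.concat_eq_append]
  rfl

theorem seg_comp {n l : ℕ} (f : Fin n → Fin l) (x : ℕ → Fin n) (i : ℕ) :
    seg (f ∘ x) i = (seg x i).map f := by
  simp [seg, List.map_ofFn, Function.comp_def]

/-- Any initial segment extends to a point on which a given predictor always errs. -/
theorem exists_evading_extension {n : ℕ} (hn : 2 ≤ n) (π : List (Fin n) → Fin n)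
    (y : ℕ → Fin n) (T : ℕ) :
    ∃ z : ℕ → Fin n, (∀ j < T, z j = y j) ∧ ∀ j, T ≤ j → z j ≠ π (seg z j) := by
  have : Nontrivial (Fin n) := Fin.nontrivial_iff_two_le.2 hn
  choose other hother using fun a : Fin n => exists_ne a
  let next : ℕ → List (Fin n) → Fin n := fun j s => if j < T then y j else other (π s)
  let L : ℕ → List (Fin n) := fun j => Nat.rec [] (fun j s => s ++ [next j s]) j
  have hL : ∀ j, seg (fun j => next j (L j)) j = L j := by
    intro j
    induction j with
    | zero => simp [seg, L]
    | succ j ih => rw [seg_succ, ih]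
  refine ⟨fun j => next j (L j), fun j hj => if_pos hj, fun j hj => ?_⟩
  rw [hL]
  simp only [next, if_neg (not_lt.2 hj)]
  exact hother _

theorem KPred.wPred {n k : ℕ} {π : List (Fin n) → Fin n} {x : ℕ → Fin n} (hk : 1 ≤ k)
    (h : KPred k π x) : WPred k π x := by
  obtain ⟨N, hN⟩ := h
  refine ⟨N, fun m hm => ?_⟩
  obtain ⟨i, h1, h2, h3⟩ := hN (m * k) (hm.trans (Nat.le_mul_of_pos_right m hk))
  refine ⟨i - m * k, by omega, ?_⟩
  rwa [Nat.add_sub_cancel' h1]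

theorem exists_not_wPred {n k : ℕ} (hn : 2 ≤ n) (π : List (Fin n) → Fin n) :
    ∃ x, ¬ WPred k π x := by
  obtain ⟨z, -, hz⟩ := exists_evading_extension hn π (fun _ => ⟨0, by omega⟩) 0
  refine ⟨z, ?_⟩
  rintro ⟨N, hN⟩
  obtain ⟨i, -, hi⟩ := hN N le_rfl
  exact hz _ (Nat.zero_le _) hi

theorem exists_not_kPred {n k : ℕ} (hn : 2 ≤ n) (hk : 1 ≤ k) (π : List (Fin n) → Fin n) :
    ∃ x, ¬ KPred k π x :=
  (exists_not_wPred hn π).imp fun _ hx h => hx (h.wPred hk)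

theorem eConst_le_eBar {n k : ℕ} (hn : 2 ≤ n) (hk : 1 ≤ k) : eConst n k ≤ eBar n k :=
  evasionNumber_le (ι := Unit) (P := KPred k) (P' := WPred k) (fun _ => id)
    (fun π => ⟨π (), fun _ h => (h ()).wPred hk⟩) (exists_not_wPred hn)

/-- A predictor for `n^ω` restricts to a predictor for `2^ω`. -/
theorem exists_predictor_restrict {n : ℕ} (hn : 2 ≤ n) (π : List (Fin n) → Fin n) :
    ∃ π' : List (Fin 2) → Fin 2, ∀ x i,
      (Fin.castLE hn ∘ x) i = π (seg (Fin.castLE hn ∘ x) i) → x i = π' (seg x i) := by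
  refine ⟨fun s => Function.invFun (Fin.castLE hn) (π (s.map (Fin.castLE hn))), fun x i h => ?_⟩
  dsimp only
  rw [← seg_comp, ← h]
  exact (Function.leftInverse_invFun (Fin.castLE_injective hn) (x i)).symm

theorem eConst_le_eConst_two {n k : ℕ} (hn : 2 ≤ n) (hk : 1 ≤ k) :
    eConst n k ≤ eConst 2 k := by
  refine evasionNumber_le (ι := Unit) (P := KPred k) (P' := KPred k)
    (fun _ x => Fin.castLE hn ∘ x) (fun π => ?_) (exists_not_kPred le_rfl hk)
  obtain ⟨π', hπ'⟩ := exists_predictor_restrict hn (π ())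
  refine ⟨π', fun x h => ?_⟩
  obtain ⟨N, hN⟩ := h ()
  exact ⟨N, fun m hm => (hN m hm).imp fun i hi => ⟨hi.1, hi.2.1, hπ' x i hi.2.2⟩⟩

theorem eBar_le_eBar_two {n k : ℕ} (hn : 2 ≤ n) : eBar n k ≤ eBar 2 k := by
  refine evasionNumber_le (ι := Unit) (P := WPred k) (P' := WPred k)
    (fun _ x => Fin.castLE hn ∘ x) (fun π => ?_) (exists_not_wPred le_rfl)
  obtain ⟨π', hπ'⟩ := exists_predictor_restrict hn (π ())
  refine ⟨π', fun x h => ?_⟩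
  obtain ⟨N, hN⟩ := h ()
  exact ⟨N, fun m hm => (hN m hm).imp fun i hi => ⟨hi.1, hπ' x _ hi.2⟩⟩

/-- A rule that computes a guess for `x t` from `x↾t` is induced by a predictor. -/
theorem exists_predictor_of_local {n : ℕ} [NeZero n] (p : (ℕ → Fin n) → ℕ → Fin n)
    (hp : ∀ x y t, (∀ j < t, x j = y j) → p x t = p y t) :
    ∃ π : List (Fin n) → Fin n, ∀ x t, π (seg x t) = p x t := by
  refine ⟨fun s => p (fun i => s.getD i 0) s.length, fun x t => ?_⟩
  have hlen : (seg x t).length = t := by simp [seg]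
  dsimp only
  rw [hlen]
  refine hp _ _ _ fun j hj => ?_
  simp [seg, hj]

section Halving

variable {n k : ℕ}

/-- The words of `C` whose entry at position `d` is `a` (all of them if `k ≤ d`). -/
def wordsWith (C : Finset (Fin k → Fin n)) (d : ℕ) (a : Fin n) : Finset (Fin k → Fin n) :=
  {w ∈ C | ∀ h : d < k, w ⟨d, h⟩ = a}

theorem exists_plurality [NeZero n] (C : Finset (Fin k → Fin n)) (d : ℕ) :
    ∃ a, ∀ b, (wordsWith C d b).card ≤ (wordsWith C d a).card :=
  Finite.exists_max fun a => (wordsWith C d a).card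

/-- A most frequent entry at position `d` among the words of `C`. -/
noncomputable def plurality [NeZero n] (C : Finset (Fin k → Fin n)) (d : ℕ) : Fin n :=
  (exists_plurality C d).choose

theorem two_mul_card_wordsWith_le [NeZero n] (C : Finset (Fin k → Fin n)) {d : ℕ} (hd : d < k)
    {b : Fin n} (hb : b ≠ plurality C d) : 2 * (wordsWith C d b).card ≤ C.card := by
  have hmax := (exists_plurality C d).choose_spec b
  have hdisj : Disjoint (wordsWith C d b) (wordsWith C d (plurality C d)) := by
    rw [Finset.disjoint_left]
    intro w h1 h2
    simp only [wordsWith, Finset.mem_filter] at h1 h2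
    exact hb ((h1.2 hd).symm.trans (h2.2 hd))
  have hsub : wordsWith C d b ∪ wordsWith C d (plurality C d) ⊆ C :=
    Finset.union_subset (Finset.filter_subset _ _) (Finset.filter_subset _ _)
  have hcard := Finset.card_le_card hsub
  rw [Finset.card_union_of_disjoint hdisj] at hcard
  change _ ≤ (wordsWith C d (plurality C d)).card at hmax
  omega

/-- The words of `B x s` compatible with `x` on `[s, t)`. -/
def candidates (B : (ℕ → Fin n) → ℕ → Finset (Fin k → Fin n)) (x : ℕ → Fin n) (s t : ℕ) :
    Finset (Fin k → Fin n) :=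
  {w ∈ B x s | ∀ i : Fin k, s + i < t → w i = x (s + i)}

/-- The position from which the guess at `t` is computed: a fresh start is made after every
correct guess, and after `k` steps at the latest. -/
noncomputable def lastStart [NeZero n] (B : (ℕ → Fin n) → ℕ → Finset (Fin k → Fin n))
    (x : ℕ → Fin n) : ℕ → ℕ
  | 0 => 0
  | t + 1 =>
    let s := lastStart B x t
    if x t = plurality (candidates B x s t) (t - s) ∨ s + k ≤ t + 1 then t + 1 else s

/-- The guess for `x t`: follow the plurality of the current candidates. -/
noncomputable def halvingGuess [NeZero n] (B : (ℕ → Fin n) → ℕ → Finset (Fin k → Fin n))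
    (x : ℕ → Fin n) (t : ℕ) : Fin n :=
  plurality (candidates B x (lastStart B x t) t) (t - lastStart B x t)

variable {B : (ℕ → Fin n) → ℕ → Finset (Fin k → Fin n)}

theorem candidates_succ (x : ℕ → Fin n) {s t : ℕ} (hst : s ≤ t) :
    candidates B x s (t + 1) = wordsWith (candidates B x s t) (t - s) (x t) := by
  ext w
  simp only [candidates, wordsWith, Finset.mem_filter, and_assoc, and_congr_right_iff]
  intro _
  constructor
  · refine fun h => ⟨fun i hi => h i (by omega), fun hd => ?_⟩
    rw [h ⟨t - s, hd⟩ (by simp only; omega)]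
    congr 1
    simp only
    omega
  · rintro ⟨h1, h2⟩ i hi
    rcases (Nat.lt_succ_iff.1 hi).lt_or_eq with hlt | heq
    · exact h1 i hlt
    · have hi' : t - s = i := by omega
      have hd : t - s < k := hi' ▸ i.2
      have := h2 hd
      rw [heq, ← this]
      congr 1
      exact Fin.ext hi'.symm

theorem candidates_self (x : ℕ → Fin n) (t : ℕ) : candidates B x t t = B x t := by
  simp [candidates]

theorem candidates_congr (hB : ∀ x y t, (∀ j < t, x j = y j) → B x t = B y t)
    {x y : ℕ → Fin n} {s t : ℕ} (hst : s ≤ t) (h : ∀ j < t, x j = y j) :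
    candidates B x s t = candidates B y s t := by
  unfold candidates
  rw [hB x y s fun j hj => h j (by omega)]
  refine Finset.filter_congr fun w _ => forall_congr' fun i => ?_
  exact imp_congr_right fun hi => by rw [h _ hi]

variable [NeZero n]

theorem lastStart_succ (x : ℕ → Fin n) (t : ℕ) :
    lastStart B x (t + 1) =
      if x t = halvingGuess B x t ∨ lastStart B x t + k ≤ t + 1 then t + 1
      else lastStart B x t := rfl

theorem lastStart_le (x : ℕ → Fin n) (t : ℕ) : lastStart B x t ≤ t := by
  induction t with
  | zero => exact le_rfl
  | succ t ih => rw [lastStart_succ]; split_ifs <;> omega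

theorem lt_lastStart_add (hk : 1 ≤ k) (x : ℕ → Fin n) (t : ℕ) : t < lastStart B x t + k := by
  induction t with
  | zero => simp only [lastStart]; omega
  | succ t ih => rw [lastStart_succ]; split_ifs <;> omega

theorem lastStart_congr (hB : ∀ x y t, (∀ j < t, x j = y j) → B x t = B y t)
    {x y : ℕ → Fin n} {t : ℕ} (h : ∀ j < t, x j = y j) :
    lastStart B x t = lastStart B y t := by
  induction t with
  | zero => rfl
  | succ t ih =>
    have hlt : ∀ j < t, x j = y j := fun j hj => h j (by omega)
    rw [lastStart_succ, lastStart_succ, halvingGuess, halvingGuess, ih hlt,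
      candidates_congr hB (lastStart_le y t) hlt, h t (by omega)]

theorem halvingGuess_congr (hB : ∀ x y t, (∀ j < t, x j = y j) → B x t = B y t)
    (x y : ℕ → Fin n) (t : ℕ) (h : ∀ j < t, x j = y j) :
    halvingGuess B x t = halvingGuess B y t := by
  rw [halvingGuess, halvingGuess, lastStart_congr hB h,
    candidates_congr hB (lastStart_le y t) h]

theorem card_candidates_succ_mul_lt {x : ℕ → Fin n} {t : ℕ} (hk : 1 ≤ k)
    (hx : x t ≠ halvingGuess B x t) {c : ℕ}
    (hc : (candidates B x (lastStart B x t) t).card * 2 ^ (t - lastStart B x t) < c) :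
    (candidates B x (lastStart B x t) (t + 1)).card * 2 ^ (t + 1 - lastStart B x t) < c := by
  have hle := lastStart_le (B := B) x t
  have hlt := lt_lastStart_add (B := B) hk x t
  have h2 := two_mul_card_wordsWith_le _ (by omega) hx
  rw [candidates_succ x hle, Nat.succ_sub hle, pow_succ]
  refine lt_of_le_of_lt ?_ hc
  calc _ = 2 * (wordsWith (candidates B x (lastStart B x t) t) (t - lastStart B x t) (x t)).card
        * 2 ^ (t - lastStart B x t) := by ring
    _ ≤ _ := Nat.mul_le_mul_right _ h2

theorem card_candidates_mul_lt (hk : 1 ≤ k) (hcard : ∀ x t, (B x t).card < 2 ^ k)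
    (x : ℕ → Fin n) (t : ℕ) :
    (candidates B x (lastStart B x t) t).card * 2 ^ (t - lastStart B x t) < 2 ^ k := by
  induction t with
  | zero => simpa [lastStart, candidates_self] using hcard x 0
  | succ t ih =>
    by_cases h : x t = halvingGuess B x t ∨ lastStart B x t + k ≤ t + 1
    · rw [lastStart_succ, if_pos h, candidates_self]
      simpa using hcard x (t + 1)
    · rw [lastStart_succ, if_neg h]
      exact card_candidates_succ_mul_lt hk (not_or.1 h).1 ih

/-- If fewer than `2 ^ k` candidates for the next `k` entries can be computed from each initial
segment, then halving predicts every point whose actual continuation is almost always among the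
candidates. -/
theorem exists_kPred_of_candidates (hk : 1 ≤ k)
    (hB : ∀ x y t, (∀ j < t, x j = y j) → B x t = B y t)
    (hcard : ∀ x t, (B x t).card < 2 ^ k) :
    ∃ π : List (Fin n) → Fin n, ∀ x : ℕ → Fin n,
      (∃ N, ∀ t, N ≤ t → (fun i : Fin k => x (t + i)) ∈ B x t) → KPred k π x := by
  obtain ⟨π, hπ⟩ := exists_predictor_of_local (halvingGuess B) (halvingGuess_congr hB)
  refine ⟨π, ?_⟩
  rintro x ⟨N, hN⟩
  refine ⟨N + k, fun m hm => ?_⟩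
  by_contra! hcon
  simp only [hπ] at hcon
  have hNm : N ≤ lastStart B x m := by
    have := lt_lastStart_add (B := B) hk x m
    omega
  have hstay : ∀ i ≤ k, lastStart B x (m + i) = lastStart B x m := by
    intro i
    induction i with
    | zero => exact fun _ => rfl
    | succ i ih =>
      intro hi
      have ih := ih (by omega)
      have hwrong := hcon (m + i) (by omega) (by omega)
      have hlt := card_candidates_succ_mul_lt hk hwrong (card_candidates_mul_lt hk hcard x (m + i))
      have hpos : 0 < (candidates B x (lastStart B x (m + i)) (m + i + 1)).card := by
        refine Finset.card_pos.2 ⟨fun i' : Fin k => x (lastStart B x (m + i) + i'), ?_⟩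
        simp only [candidates, Finset.mem_filter, implies_true, and_true]
        exact hN _ (by omega)
      have hpow := (Nat.le_mul_of_pos_left _ hpos).trans_lt hlt
      have hexp := (Nat.pow_lt_pow_iff_right (by norm_num)).1 hpow
      rw [← add_assoc, lastStart_succ, if_neg (not_or.2 ⟨hwrong, by omega⟩), ih]
  have h1 := hstay k le_rfl
  have h2 := lt_lastStart_add (B := B) hk x (m + k)
  have h3 := lastStart_le (B := B) x m
  omega

end Halving

section Splice

variable {n k : ℕ} [NeZero n]

/-- The sequence that agrees with `x` below `t` and continues with the word `w`. -/
def splice (x : ℕ → Fin n) (t : ℕ) (w : Fin k → Fin n) : ℕ → Fin n :=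
  fun j => if j < t then x j else if h : j - t < k then w ⟨j - t, h⟩ else 0

theorem splice_of_lt (x : ℕ → Fin n) (w : Fin k → Fin n) {t j : ℕ} (h : j < t) :
    splice x t w j = x j := if_pos h

theorem splice_add (x : ℕ → Fin n) (w : Fin k → Fin n) (t : ℕ) (i : Fin k) :
    splice x t w (t + i) = w i := by
  simp [splice]

theorem splice_congr {x y : ℕ → Fin n} {t : ℕ} (h : ∀ j < t, x j = y j) (w : Fin k → Fin n) :
    splice x t w = splice y t w := by
  funext j
  unfold splice
  split_ifs with h1
  · exact h j h1
  all_goals rfl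

end Splice

section Coding

variable {n k : ℕ} [NeZero k]

/-- The binary sequence obtained by applying `g` to the consecutive length-`k` blocks of `x`
from position `r` on. -/
def blockCode (r : ℕ) (g : (Fin k → Fin n) → Fin k → Fin 2) (x : ℕ → Fin n) : ℕ → Fin 2 :=
  fun j => g (fun i => x (j / k * k + r + i)) (Fin.ofNat k j)

theorem blockCode_block (r : ℕ) (g : (Fin k → Fin n) → Fin k → Fin 2) (x : ℕ → Fin n) (m : ℕ)
    (i : Fin k) :
    blockCode r g x (m * k + i) = g (fun i => x (m * k + r + i)) i := by
  have h1 : (m * k + i) / k = m := by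
    rw [mul_comm, Nat.mul_add_div (NeZero.pos k), Nat.div_eq_of_lt i.2, add_zero]
  have h2 : Fin.ofNat k (m * k + i) = i := by
    ext
    rw [Fin.val_ofNat, mul_comm, Nat.mul_add_mod, Nat.mod_eq_of_lt i.2]
  simp only [blockCode, h1, h2]

theorem blockCode_congr (r : ℕ) (g : (Fin k → Fin n) → Fin k → Fin 2) {x y : ℕ → Fin n} {m : ℕ}
    (h : ∀ j < m * k + r, x j = y j) :
    ∀ j < m * k, blockCode r g x j = blockCode r g y j := by
  intro j hj
  unfold blockCode
  congr 1
  funext i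
  apply h
  have h1 : j / k < m := Nat.div_lt_of_lt_mul (by rwa [mul_comm])
  have h2 : (j / k + 1) * k ≤ m * k := Nat.mul_le_mul_right k h1
  have h3 := i.2
  rw [Nat.succ_mul] at h2
  omega

variable [NeZero n]

/-- The words `w` such that, if `x↾t` is continued by `w`, all the codes with residue `t % k`
are guessed correctly somewhere in the corresponding block. -/
noncomputable def predictedWords
    (π : ℕ → ((Fin k → Fin n) → Fin k → Fin 2) → List (Fin 2) → Fin 2)
    (x : ℕ → Fin n) (t : ℕ) : Finset (Fin k → Fin n) :=
  open Classical in
  {w | ∀ g, ∃ i < k, blockCode (t % k) g (splice x t w) (t / k * k + i) =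
    π (t % k) g (seg (blockCode (t % k) g (splice x t w)) (t / k * k + i))}

variable (π : ℕ → ((Fin k → Fin n) → Fin k → Fin 2) → List (Fin 2) → Fin 2)

theorem mem_predictedWords_iff {x : ℕ → Fin n} {t : ℕ} {w : Fin k → Fin n} :
    w ∈ predictedWords π x t ↔
      ∀ g, ∃ i < k, blockCode (t % k) g (splice x t w) (t / k * k + i) =
        π (t % k) g (seg (blockCode (t % k) g (splice x t w)) (t / k * k + i)) := by
  simp only [predictedWords, Finset.mem_filter, Finset.mem_univ, true_and]

theorem predictedWords_congr (x y : ℕ → Fin n) (t : ℕ) (h : ∀ j < t, x j = y j) :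
    predictedWords π x t = predictedWords π y t := by
  unfold predictedWords
  simp only [splice_congr h]

theorem card_predictedWords_lt (x : ℕ → Fin n) (t : ℕ) :
    (predictedWords π x t).card < 2 ^ k := by
  by_contra! hcard
  have hcard' : Fintype.card (Fin k → Fin 2) ≤ Fintype.card (predictedWords π x t) := by
    simpa using hcard
  obtain ⟨e⟩ := Function.Embedding.nonempty_of_card_le hcard'
  let g : (Fin k → Fin n) → (Fin k → Fin 2) := Function.invFun fun v => (e v : Fin k → Fin n)
  have hg : ∀ v, g (e v) = v :=
    Function.leftInverse_invFun (Subtype.val_injective.comp e.injective)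
  obtain ⟨z, hz1, hz2⟩ := exists_evading_extension le_rfl (π (t % k) g)
    (blockCode (t % k) g x) (t / k * k)
  let v : Fin k → Fin 2 := fun i => z (t / k * k + i)
  have ht : t / k * k + t % k = t := Nat.div_add_mod' t k
  have hagree : ∀ j < t / k * k + k, blockCode (t % k) g (splice x t (e v).1) j = z j := by
    intro j hj
    rcases lt_or_ge j (t / k * k) with hlt | hge
    · rw [hz1 j hlt]
      refine blockCode_congr _ g (fun j' hj' => splice_of_lt x _ ?_) j hlt
      rwa [ht] at hj'
    · obtain ⟨i, rfl⟩ := Nat.exists_eq_add_of_le hge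
      have hi : i < k := by omega
      rw [blockCode_block (t % k) g _ (t / k) ⟨i, hi⟩, ht]
      simp only [splice_add, hg, v]
  obtain ⟨i, hi, heq⟩ := (mem_predictedWords_iff π).1 (e v).2 g
  rw [hagree _ (by omega), seg_congr fun j hj => hagree j (by omega)] at heq
  exact hz2 _ (by omega) heq

theorem block_mem_predictedWords {x : ℕ → Fin n} {t : ℕ}
    (h : ∀ g, ∃ i < k, blockCode (t % k) g x (t / k * k + i) =
      π (t % k) g (seg (blockCode (t % k) g x) (t / k * k + i))) :
    (fun i : Fin k => x (t + i)) ∈ predictedWords π x t := by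
  refine (mem_predictedWords_iff π).2 fun g => ?_
  have hsplice : ∀ j < (t / k + 1) * k + t % k,
      splice x t (fun i : Fin k => x (t + i)) j = x j := by
    intro j hj
    have ht : t / k * k + t % k = t := Nat.div_add_mod' t k
    rw [Nat.succ_mul] at hj
    rcases lt_or_ge j t with hlt | hge
    · exact splice_of_lt x _ hlt
    · obtain ⟨i, rfl⟩ := Nat.exists_eq_add_of_le hge
      exact splice_add x _ t ⟨i, by omega⟩
  have hagree := blockCode_congr (t % k) g hsplice
  rw [Nat.succ_mul] at hagree
  obtain ⟨i, hi, heq⟩ := h g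
  refine ⟨i, hi, ?_⟩
  rw [hagree _ (by omega), seg_congr fun j hj => hagree j (by omega)]
  exact heq

end Coding

theorem eBar_two_le_eConst {n k : ℕ} (hn : 2 ≤ n) (hk : 1 ≤ k) : eBar 2 k ≤ eConst n k := by
  have : NeZero n := ⟨by omega⟩
  have : NeZero k := ⟨by omega⟩
  refine evasionNumber_le (ι := Fin k × ((Fin k → Fin n) → Fin k → Fin 2))
    (P := WPred k) (P' := KPred k) (fun j => blockCode j.1 j.2) (fun π => ?_)
    (exists_not_kPred hn hk)
  have hr : ∀ t, ((Fin.ofNat k (t % k) : Fin k) : ℕ) = t % k := fun t => by simp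
  let ρ := fun r g => π (Fin.ofNat k r, g)
  obtain ⟨π', hπ'⟩ := exists_kPred_of_candidates hk (predictedWords_congr ρ)
    (card_predictedWords_lt ρ)
  refine ⟨π', fun x hx => hπ' x ?_⟩
  choose N hN using hx
  refine ⟨Finset.univ.sup N * k, fun t ht => block_mem_predictedWords ρ fun g => ?_⟩
  have hle : N (Fin.ofNat k (t % k), g) ≤ t / k :=
    (Finset.le_sup (Finset.mem_univ _)).trans
      ((Nat.le_div_iff_mul_le hk).2 ht)
  simpa only [hr] using hN (Fin.ofNat k (t % k), g) (t / k) hle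

/-- Theorem 1.2 (dual): `𝔢̄ₙᶜᵒⁿˢᵗ(k) = 𝔢ₙᶜᵒⁿˢᵗ(k) = 𝔢₂ᶜᵒⁿˢᵗ(k)` for all `n ≥ 2`, `k ≥ 1`. -/
theorem stmt5 (n k : ℕ) (hn : 2 ≤ n) (hk : 1 ≤ k) :
    eBar n k = eConst n k ∧ eConst n k = eConst 2 k :=
  ⟨((eBar_le_eBar_two hn).trans (eBar_two_le_eConst hn hk)).antisymm (eConst_le_eBar hn hk),
    (eConst_le_eConst_two hn hk).antisymm
      ((eConst_le_eBar le_rfl hk).trans (eBar_two_le_eConst hn hk))⟩
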